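/- Let A be a live weakly-hierarchical visibly pushdown automaton and let w be a matched-return word over Σ. Then every initial run of A on a prefix of w can be extended to an initial run of A on all of w; in particular, for every q_0 ∈ Q0 there exists an initial run of A on w starting in configuration (q_0, ⊥). -/

import Mathlib

/-- The kind of a symbol in a visibly pushdown alphabet:
internal, call, or return. -/
inductive SymKind : Type
  | int | call | ret
deriving DecidableEq

/-- A weakly-hierarchical visibly pushdown automaton over states `Q` and
alphabet `S`.  The partition of the alphabet is given by `kind`; the
bottom-of-stack symbol is implicit (stacks are lists of states, the empty
list playing the role of `⊥`, and the head of the list being the topmost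
symbol). -/
structure VPA (Q : Type) (S : Type) where
  kind : S → SymKind
  δi : Q → S → Q → Prop
  δc : Q → S → Q → Prop
  δr : Q → S → Q → Q → Prop
  Q0 : Set Q
  F : Set Q
  Q0_nonempty : Q0.Nonempty
  δi_kind : ∀ p a q, δi p a q → kind a = SymKind.int
  δc_kind : ∀ p c q, δc p c q → kind c = SymKind.call
  δr_kind : ∀ p r qh q, δr p r qh q → kind r = SymKind.ret

namespace VPA

variable {Q S : Type}

/-- A configuration: current state together with the stack
(head = topmost symbol; `[]` = the empty stack `⊥`). -/
abbrev Config (Q : Type) := Q × List Q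

/-- One step of the automaton on a symbol. Internal symbols leave the stack
unchanged, call symbols push the current state, return symbols pop the
matching topmost stack symbol. -/
def Step (A : VPA Q S) (c : Config Q) (s : S) (c' : Config Q) : Prop :=
  match A.kind s with
  | SymKind.int  => A.δi c.1 s c'.1 ∧ c'.2 = c.2
  | SymKind.call => A.δc c.1 s c'.1 ∧ c'.2 = c.1 :: c.2
  | SymKind.ret  => ∃ qh, A.δr c.1 s qh c'.1 ∧ c.2 = qh :: c'.2

/-- `ρ` is a run of `A` on the word `w`. -/
def IsRunOn (A : VPA Q S) (w : List S) (ρ : Fin (w.length + 1) → Config Q) : Prop :=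
  ∀ i : Fin w.length, A.Step (ρ i.castSucc) (w.get i) (ρ i.succ)

/-- A run is initial if it starts in an initial state with the empty stack `⊥`. -/
def IsInitial (A : VPA Q S) {n : ℕ} (ρ : Fin (n + 1) → Config Q) : Prop :=
  (ρ 0).1 ∈ A.Q0 ∧ (ρ 0).2 = []

/-- `A` accepts `w` if some initial run of `A` on `w` ends in an accepting state. -/
def Accepts (A : VPA Q S) (w : List S) : Prop :=
  ∃ ρ : Fin (w.length + 1) → Config Q,
    A.IsRunOn w ρ ∧ A.IsInitial ρ ∧ (ρ (Fin.last w.length)).1 ∈ A.F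

/-- The language of `A`. -/
def lang (A : VPA Q S) : Set (List S) := {w | A.Accepts w}

/-- A configuration is reachable if it occurs in some initial run of `A`. -/
def Reachable (A : VPA Q S) (c : Config Q) : Prop :=
  ∃ (w : List S) (ρ : Fin (w.length + 1) → Config Q),
    A.IsRunOn w ρ ∧ A.IsInitial ρ ∧ ∃ i, ρ i = c

/-- `tops A q` = set of topmost stack symbols of reachable stacks for `q`
(`none` plays the role of the bottom-of-stack symbol `⊥`). -/
def tops (A : VPA Q S) (q : Q) : Set (Option Q) :=
  {t | ∃ σ : List Q, A.Reachable (q, σ) ∧ σ.head? = t}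

/-- `A` is live: every state has outgoing transitions for every internal and
call symbol, and has an outgoing return transition for return symbol `s` and
stack symbol `qh` if and only if `qh` is the topmost symbol of some
reachable stack. -/
def Live (A : VPA Q S) : Prop :=
  (∀ q s, A.kind s = SymKind.int → ∃ q', A.δi q s q') ∧
  (∀ q s, A.kind s = SymKind.call → ∃ q', A.δc q s q') ∧
  (∀ q s qh, A.kind s = SymKind.ret →
    ((∃ q', A.δr q s qh q') ↔ some qh ∈ A.tops q))

/-- `R` is a reachability-aware quotienting (RAQ) relation for `A`. -/
def IsRAQ (A : VPA Q S) (R : Q → Q → Prop) : Prop :=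
  Equivalence R ∧
  ∀ p q, R p q →
    (p ∈ A.F ↔ q ∈ A.F) ∧
    (∀ a p', A.δi p a p' → ∃ q', A.δi q a q' ∧ R p' q') ∧
    (∀ a q', A.δi q a q' → ∃ p', A.δi p a p' ∧ R p' q') ∧
    (∀ c p', A.δc p c p' → ∃ q', A.δc q c q' ∧ R p' q') ∧
    (∀ c q', A.δc q c q' → ∃ p', A.δc p c p' ∧ R p' q') ∧
    (∀ ph qh, R ph qh →
      ((∀ r p', A.δr p r ph p' → ∃ q', A.δr q r qh q' ∧ R p' q') ∧
       (∀ r q', A.δr q r qh q' → ∃ p', A.δr p r ph p' ∧ R p' q'))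
      ∨ some qh ∉ A.tops q ∨ some ph ∉ A.tops p)

/-- The quotient VPA `A/R` for an equivalence relation (setoid) `R` on states. -/
def quot (A : VPA Q S) (R : Setoid Q) : VPA (Quotient R) S where
  kind := A.kind
  δi := fun P a P' => ∃ p p', A.δi p a p' ∧
    Quotient.mk R p = P ∧ Quotient.mk R p' = P'
  δc := fun P c P' => ∃ p p', A.δc p c p' ∧
    Quotient.mk R p = P ∧ Quotient.mk R p' = P'
  δr := fun P r Ph P' => ∃ p ph p', A.δr p r ph p' ∧
    Quotient.mk R p = P ∧ Quotient.mk R ph = Ph ∧ Quotient.mk R p' = P'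
  Q0 := {P | ∃ q ∈ A.Q0, Quotient.mk R q = P}
  F := {P | ∃ q ∈ A.F, Quotient.mk R q = P}
  Q0_nonempty := by
    obtain ⟨q, hq⟩ := A.Q0_nonempty
    exact ⟨Quotient.mk R q, q, hq, rfl⟩
  δi_kind := by rintro P a P' ⟨p, p', h, -, -⟩; exact A.δi_kind p a p' h
  δc_kind := by rintro P c P' ⟨p, p', h, -, -⟩; exact A.δc_kind p c p' h
  δr_kind := by rintro P r Ph P' ⟨p, ph, p', h, -, -, -⟩; exact A.δr_kind p r ph p' h

end VPA

/-- A word is matched-return if every prefix ending in a return symbol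
has strictly more call symbols than return symbols before that return. -/
def MR {S : Type} (kind : S → SymKind) (w : List S) : Prop :=
  ∀ v r, (v ++ [r]) <+: w → kind r = SymKind.ret →
    v.countP (fun s => decide (kind s = SymKind.call)) >
      v.countP (fun s => decide (kind s = SymKind.ret))

namespace VPA

variable {Q S : Type}

/-- The configurations `f 0, …, f k` form a run on the first `k` symbols of `w`. -/
def StepsUpTo (A : VPA Q S) (w : List S) (k : ℕ) (f : ℕ → Config Q) : Prop :=
  ∀ i, i < k → ∀ h : i < w.length, A.Step (f i) w[i] (f (i + 1))

/-- Along a run from the empty stack, the stack height is the number of calls minus the number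
of returns read so far. -/
lemma StepsUpTo.length_stack_add {A : VPA Q S} {w : List S} {k : ℕ} {f : ℕ → Config Q}
    (hf : A.StepsUpTo w k f) (h0 : (f 0).2 = []) (hk : k ≤ w.length) :
    (f k).2.length + (w.take k).countP (fun s => decide (A.kind s = SymKind.ret)) =
      (w.take k).countP (fun s => decide (A.kind s = SymKind.call)) := by
  induction k with
  | zero => simp [h0]
  | succ k ih =>
    have hlt : k < w.length := hk
    have ih := ih (fun i hi h => hf i (by omega) h) hlt.le
    have hs := hf k (by omega) hlt
    rw [List.take_succ_eq_append_getElem hlt, List.countP_append, List.countP_append]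
    unfold Step at hs
    rcases hkind : A.kind w[k] with _ | _ | _ <;> rw [hkind] at hs
    · obtain ⟨-, hs⟩ := hs
      simp [hs, hkind]
      omega
    · obtain ⟨-, hs⟩ := hs
      simp [hs, hkind]
      omega
    · obtain ⟨qh, -, hs⟩ := hs
      simp [hs] at ih
      simp [hkind]
      omega

lemma StepsUpTo.isRunOn_take {A : VPA Q S} {w : List S} {k : ℕ} {f : ℕ → Config Q}
    (hf : A.StepsUpTo w k f) :
    A.IsRunOn (w.take k) (fun i => f i) := by
  intro i
  have hi : (i : ℕ) < k ∧ (i : ℕ) < w.length := by simpa using i.isLt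
  simpa using hf i hi.1 hi.2

lemma StepsUpTo.reachable {A : VPA Q S} {w : List S} {k : ℕ} {f : ℕ → Config Q}
    (hf : A.StepsUpTo w k f) (h0 : (f 0).1 ∈ A.Q0 ∧ (f 0).2 = []) (hk : k ≤ w.length) :
    A.Reachable (f k) :=
  ⟨w.take k, fun i => f i, hf.isRunOn_take, h0, Fin.last _, by simp [hk]⟩

lemma Live.exists_step {A : VPA Q S} (hlive : A.Live) {w : List S} (hw : MR A.kind w)
    {k : ℕ} {f : ℕ → Config Q} (hf : A.StepsUpTo w k f)
    (h0 : (f 0).1 ∈ A.Q0 ∧ (f 0).2 = []) (hk : k < w.length) :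
    ∃ c, A.Step (f k) w[k] c := by
  unfold Step
  rcases hkind : A.kind w[k] with _ | _ | _
  · obtain ⟨q, hq⟩ := hlive.1 (f k).1 _ hkind
    exact ⟨(q, (f k).2), hq, rfl⟩
  · obtain ⟨q, hq⟩ := hlive.2.1 (f k).1 _ hkind
    exact ⟨(q, (f k).1 :: (f k).2), hq, rfl⟩
  · have hlen := hf.length_stack_add h0.2 hk.le
    have hgt := hw (w.take k) w[k]
      (by rw [← List.take_succ_eq_append_getElem hk]; exact List.take_prefix _ _) hkind
    rcases hst : (f k).2 with _ | ⟨qh, σ⟩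
    · rw [hst, List.length_nil] at hlen
      omega
    · obtain ⟨q, hq⟩ := (hlive.2.2 (f k).1 w[k] qh hkind).2
        ⟨(f k).2, hf.reachable h0 hk.le, by simp [hst]⟩
      exact ⟨(q, σ), qh, hq, rfl⟩

lemma Live.exists_stepsUpTo_length {A : VPA Q S} (hlive : A.Live) {w : List S}
    (hw : MR A.kind w) {k : ℕ} {f : ℕ → Config Q} (hf : A.StepsUpTo w k f)
    (h0 : (f 0).1 ∈ A.Q0 ∧ (f 0).2 = []) (hk : k ≤ w.length) :
    ∃ g : ℕ → Config Q, A.StepsUpTo w w.length g ∧ ∀ i ≤ k, g i = f i := by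
  induction hn : w.length - k generalizing k f with
  | zero =>
    obtain rfl : k = w.length := by omega
    exact ⟨f, hf, fun _ _ => rfl⟩
  | succ n ih =>
    have hlt : k < w.length := by omega
    obtain ⟨c, hc⟩ := hlive.exists_step hw hf h0 hlt
    have hupd : ∀ i ≤ k, Function.update f (k + 1) c i = f i := fun i hi =>
      Function.update_of_ne (by omega) _ _
    have hf' : A.StepsUpTo w (k + 1) (Function.update f (k + 1) c) := by
      intro i hi h
      rw [hupd i (by omega)]
      rcases Nat.lt_succ_iff_lt_or_eq.1 hi with hik | rfl
      · rw [hupd (i + 1) hik]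
        exact hf i hik h
      · rwa [Function.update_self]
    obtain ⟨g, hg, hgf⟩ := ih hf' (by rwa [hupd 0 (Nat.zero_le k)]) hlt (by omega)
    exact ⟨g, hg, fun i hi => (hgf i (by omega)).trans (hupd i hi)⟩

end VPA

/-- In a live VPA, every initial run on a prefix of a matched-return word `w`
extends to an initial run on all of `w`; in particular, from every initial
state there is an initial run on `w`. -/
theorem run_extension_mr {Q S : Type} [Fintype Q] [Fintype S]
    (A : VPA Q S) (hlive : A.Live) (w : List S) (hw : MR A.kind w) :
    (∀ (k : ℕ) (hk : k ≤ w.length) (ρ : Fin (k + 1) → VPA.Config Q),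
      A.IsInitial ρ →
      (∀ i : Fin k,
        A.Step (ρ i.castSucc) (w.get ⟨i, lt_of_lt_of_le i.isLt hk⟩) (ρ i.succ)) →
      ∃ ρ' : Fin (w.length + 1) → VPA.Config Q,
        A.IsRunOn w ρ' ∧ A.IsInitial ρ' ∧
        ∀ i : Fin (k + 1), ρ' (Fin.castLE (Nat.succ_le_succ hk) i) = ρ i) ∧
    (∀ q0 ∈ A.Q0, ∃ ρ' : Fin (w.length + 1) → VPA.Config Q,
      A.IsRunOn w ρ' ∧ ρ' 0 = (q0, [])) := by
  have extend : ∀ (k : ℕ) (hk : k ≤ w.length) (ρ : Fin (k + 1) → VPA.Config Q),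
      A.IsInitial ρ →
      (∀ i : Fin k,
        A.Step (ρ i.castSucc) (w.get ⟨i, lt_of_lt_of_le i.isLt hk⟩) (ρ i.succ)) →
      ∃ ρ' : Fin (w.length + 1) → VPA.Config Q,
        A.IsRunOn w ρ' ∧ A.IsInitial ρ' ∧
        ∀ i : Fin (k + 1), ρ' (Fin.castLE (Nat.succ_le_succ hk) i) = ρ i := by
    intro k hk ρ hinit hrun
    let f : ℕ → VPA.Config Q := fun i => ρ (Fin.ofNat (k + 1) i)
    have hval : ∀ i (hi : i < k + 1), f i = ρ ⟨i, hi⟩ := fun i hi =>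
      congrArg ρ (Fin.ext (Nat.mod_eq_of_lt hi))
    have hf : A.StepsUpTo w k f := by
      intro i hi h
      rw [hval i (by omega), hval (i + 1) (by omega)]
      exact hrun ⟨i, hi⟩
    have h0 : f 0 = ρ 0 := hval 0 (Nat.succ_pos k)
    obtain ⟨g, hg, hgf⟩ := hlive.exists_stepsUpTo_length hw hf (by rwa [h0]) hk
    have hg0 : g 0 = ρ 0 := (hgf 0 (Nat.zero_le k)).trans h0
    refine ⟨fun i => g i, fun i => hg i i.isLt i.isLt, ?_, fun i => ?_⟩
    · change (g 0).1 ∈ A.Q0 ∧ (g 0).2 = []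
      rwa [hg0]
    · exact (hgf i (by omega)).trans (hval i i.isLt)
  refine ⟨extend, fun q0 hq0 => ?_⟩
  obtain ⟨ρ', hrun, -, hρ'⟩ :=
    extend 0 (Nat.zero_le _) (fun _ => (q0, [])) ⟨hq0, rfl⟩ (fun i => i.elim0)
  exact ⟨ρ', hrun, hρ' 0⟩
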